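/- Let m be a positive integer or half-integer (2m ∈ ℕ) and let n, ν be integers with 0 ≤ n < 2m and 0 ≤ ν ≤ 2m. Let τ lie in the upper half-plane and z ∈ ℂ with m·z ∉ ℤ + ℤτ. Then G^{[m]}_{n,ν}(τ, z) = −((−1)^ν/(2m)) η(τ)³ ∑_{ℓ=0}^{2m−1} e^{πinℓ/m} · θ^{(−)}_{ν+1/2, m+1/2}(τ, z − ℓ/m) / θ^{(−)}_{1/2, 1/2}(τ, z − ℓ/m). -/

import Mathlib

noncomputable section

open Complex

/-- `e2 w = exp (2 π i w)`; with `q = e^{2πiτ}`, the power `q^x` corresponds to `e2 (x * τ)`. -/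
def e2 (w : ℂ) : ℂ := Complex.exp (2 * (Real.pi : ℂ) * Complex.I * w)

/-- Jacobi-type theta function `θ^{(ε)}_{n,m}(τ, z) = ∑_{j∈ℤ} ε^j q^{m(j+n/(2m))²} e^{2πim(j+n/(2m))z}`. -/
def jtheta (ε n m τ z : ℂ) : ℂ :=
  ∑' j : ℤ, ε ^ j *
    e2 (m * ((j : ℂ) + n / (2 * m)) ^ 2 * τ + m * ((j : ℂ) + n / (2 * m)) * z)

/-- Mock theta function `Φ₁^{(ε)[m,s]}(τ, z₁, z₂)`. -/
def Phi1 (ε m s τ z₁ z₂ : ℂ) : ℂ :=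
  ∑' j : ℤ, ε ^ j *
    e2 (m * (j : ℂ) * (z₁ + z₂) + s * z₁ + (m * (j : ℂ) ^ 2 + s * (j : ℂ)) * τ) /
      (1 - e2 (z₁ + (j : ℂ) * τ))

/-- Dedekind eta function `η(τ) = q^{1/24} ∏_{k≥1} (1 - q^k)`. -/
def dedekindEta (τ : ℂ) : ℂ := e2 (τ / 24) * ∏' k : ℕ, (1 - e2 (((k : ℂ) + 1) * τ))

/-- Jacobi theta `ϑ₁₁(τ, z) = i ∑_{j∈ℤ} (−1)^j q^{(j+1/2)²/2} e^{2πi(j+1/2)z}`. -/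
def theta11 (τ z : ℂ) : ℂ :=
  Complex.I * ∑' j : ℤ, (-1 : ℂ) ^ j *
    e2 (((j : ℂ) + 1 / 2) ^ 2 / 2 * τ + ((j : ℂ) + 1 / 2) * z)

/-- Indefinite double sum `(∑_{j,p∈ℤ, 0<p≤j} − ∑_{j,p∈ℤ, j<p≤0}) f j p`. -/
def indefSum (f : ℤ → ℤ → ℂ) : ℂ :=
  ∑' jp : ℤ × ℤ,
    ((if 0 < jp.2 ∧ jp.2 ≤ jp.1 then f jp.1 jp.2 else 0) -
      (if jp.1 < jp.2 ∧ jp.2 ≤ 0 then f jp.1 jp.2 else 0))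

/-- `g^{[m]}_{n,ν}(τ)`. -/
def gfun (m : ℂ) (n ν : ℤ) (τ : ℂ) : ℂ :=
  indefSum fun j p =>
    (-1 : ℂ) ^ j *
      e2 (((m + 1 / 2) * ((j : ℂ) + (ν : ℂ) - ((ν : ℂ) + 1 / 2) / (2 * m + 1)) ^ 2 -
        m * ((p : ℂ) + (ν : ℂ) - (n : ℂ) / (2 * m)) ^ 2) * τ)

/-- `h^{[m]}_{n,ν}(τ, z)`. -/
def hfun (m : ℂ) (n ν : ℤ) (τ z : ℂ) : ℂ :=
  ∑' j : ℤ,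
    e2 (m * (j : ℂ) * z + (n : ℂ) * z / 2 +
        (m * (j : ℂ) ^ 2 + (n : ℂ) * ((j : ℂ) + (ν : ℂ))) * τ) /
      (1 - e2 (m * z + 2 * m * ((j : ℂ) + (ν : ℂ)) * τ))

/-- `G^{[m]}_{n,ν}(τ, z)`. -/
def Gfun (m : ℂ) (n ν : ℤ) (τ z : ℂ) : ℂ :=
  gfun m n ν τ * jtheta 1 (n : ℂ) m τ z +
    (-1 : ℂ) ^ ν * e2 (-(m * (ν : ℂ) ^ 2) * τ) *
      jtheta (-1) ((ν : ℂ) + 1 / 2) (m + 1 / 2) τ 0 * hfun m n ν τ z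

/-- `F^{[m](a,b)}_{n,ν}(τ, z)`. -/
def Ffun (m : ℂ) (a b n ν : ℤ) (τ z : ℂ) : ℂ :=
  e2 ((a : ℂ) * z / 2 + (a : ℂ) ^ 2 / (4 * m) * τ) *
    Gfun m n ν τ (z + (a : ℂ) * τ / m + (b : ℂ) / m)

/-- The coefficient `f_{j,k}` of Lemma 3.1:
`f_{j,k} = (−1)^j q^{(m+1/2)(j+s/(2m+1))² − k²/(4m)} e^{−2πijm(z₁−z₂)+πik(z₁−z₂)}`. -/
def fcoef (m s τ z₁ z₂ : ℂ) (j k : ℤ) : ℂ :=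
  (-1 : ℂ) ^ j *
    e2 (((m + 1 / 2) * ((j : ℂ) + s / (2 * m + 1)) ^ 2 - (k : ℂ) ^ 2 / (4 * m)) * τ +
      (-((j : ℂ) * m) + (k : ℂ) / 2) * (z₁ - z₂))


lemma e2_add (x y : ℂ) : e2 (x + y) = e2 x * e2 y := by
  unfold e2; rw [← Complex.exp_add]; ring_nf

lemma e2_zero : e2 0 = 1 := by simp [e2]

lemma e2_ne (x : ℂ) : e2 x ≠ 0 := Complex.exp_ne_zero _

lemma e2_eq_one {x : ℂ} (h : e2 x = 1) : ∃ a : ℤ, x = a := by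
  unfold e2 at h
  rw [Complex.exp_eq_one_iff] at h
  obtain ⟨a, ha⟩ := h
  refine ⟨a, ?_⟩
  have h2 : (2 * (Real.pi : ℂ) * I) ≠ 0 := Complex.two_pi_I_ne_zero
  apply mul_left_cancel₀ h2
  rw [ha]; ring

lemma e2_int (a : ℤ) : e2 a = 1 := by
  unfold e2
  rw [Complex.exp_eq_one_iff]
  exact ⟨a, by ring⟩

lemma e2_add_int (x : ℂ) (a : ℤ) : e2 (x + a) = e2 x := by
  rw [e2_add, e2_int, mul_one]

/-- equality of exponentials when the arguments differ by an integer -/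
lemma e2_congr {x y : ℂ} (a : ℤ) (h : x = y + a) : e2 x = e2 y := by
  rw [h, e2_add_int]

lemma e2_half : e2 (1 / 2) = -1 := by
  unfold e2
  rw [show 2 * (Real.pi : ℂ) * I * (1 / 2) = Real.pi * I by ring, Complex.exp_pi_mul_I]

lemma e2_neg (x : ℂ) : e2 (-x) = (e2 x)⁻¹ := by
  unfold e2; rw [← Complex.exp_neg]; ring_nf

lemma e2_int_mul (j : ℤ) (x : ℂ) : e2 (j * x) = e2 x ^ j := by
  unfold e2; rw [← Complex.exp_int_mul]; ring_nf

lemma neg_one_zpow_e2 (j : ℤ) : (-1 : ℂ) ^ j = e2 (j / 2) := by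
  rw [← e2_half, ← e2_int_mul]; ring_nf

lemma norm_e2 (x : ℂ) : ‖e2 x‖ = Real.exp (-(2 * Real.pi * x.im)) := by
  unfold e2
  rw [Complex.norm_exp]
  congr 1
  simp

lemma e2_nat_mul (j : ℕ) (x : ℂ) : e2 (j * x) = e2 x ^ j := by
  have := e2_int_mul j x
  simpa using this

/-! ### Summability -/

lemma summable_gauss {τ : ℂ} (hτ : 0 < τ.im) (c : ℝ) (hc : 0 < c) (u : ℂ) :
    Summable fun j : ℤ => e2 ((j : ℂ) ^ 2 * (c * τ) + j * u) := by
  have h := (summable_jacobiTheta₂_term_iff u (2 * c * τ)).2 (by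
    simp
    positivity)
  refine h.congr fun j => ?_
  unfold jacobiTheta₂_term e2
  congr 1; ring

lemma summable_gauss_add {τ : ℂ} (hτ : 0 < τ.im) (c : ℝ) (hc : 0 < c) (u d : ℂ) :
    Summable fun j : ℤ => e2 ((j : ℂ) ^ 2 * (c * τ) + j * u + d) := by
  refine ((summable_gauss hτ c hc u).mul_right (e2 d)).congr fun j => ?_
  rw [← e2_add]

lemma summable_two {τ : ℂ} (hτ : 0 < τ.im) (c : ℝ) (hc : 0 < c) (u v : ℂ) (C : ℝ)
    (f : ℤ × ℤ → ℂ)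
    (hf : ∀ j k : ℤ, ‖f (j, k)‖ ≤
      C * (‖e2 ((j : ℂ) ^ 2 * (c * τ) + j * u)‖ * ‖e2 ((k : ℂ) ^ 2 * (c * τ) + k * v)‖)) :
    Summable f := by
  have h := (summable_gauss hτ c hc u).norm.mul_of_nonneg (summable_gauss hτ c hc v).norm
    (fun _ => norm_nonneg _) (fun _ => norm_nonneg _)
  exact Summable.of_norm_bounded (h.mul_left C) fun x => hf x.1 x.2

lemma bdd_inv {τ : ℂ} (hτ : 0 < τ.im) (v : ℂ) :
    ∃ C : ℝ, 0 ≤ C ∧ ∀ k : ℤ, ‖(1 - e2 (v + k * τ))⁻¹‖ ≤ C := by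
  have hq : ‖e2 τ‖ < 1 := by
    rw [norm_e2, Real.exp_lt_one_iff]
    have := Real.pi_pos
    nlinarith [mul_pos this hτ]
  have hpow := tendsto_pow_atTop_nhds_zero_of_norm_lt_one hq
  have h1 : Filter.Tendsto (fun n : ℕ => ‖(1 - e2 (v + n * τ))⁻¹‖) Filter.atTop
      (nhds ‖(1 - e2 v * 0 : ℂ)⁻¹‖) := by
    refine Filter.Tendsto.norm (Filter.Tendsto.inv₀ ?_ (by simp))
    refine Filter.Tendsto.sub tendsto_const_nhds ?_
    refine (hpow.const_mul (e2 v)).congr fun n => ?_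
    rw [e2_add, e2_nat_mul]
  have h2 : Filter.Tendsto (fun n : ℕ => ‖(1 - e2 (v + (-(n:ℂ)) * τ))⁻¹‖) Filter.atTop
      (nhds ‖(-((e2 v)⁻¹ * 0) * (1 - (e2 v)⁻¹ * 0 : ℂ)⁻¹)‖) := by
    have ht := (hpow.const_mul (e2 v)⁻¹)
    have : Filter.Tendsto (fun n : ℕ => ‖-((e2 v)⁻¹ * e2 τ ^ n) * (1 - (e2 v)⁻¹ * e2 τ ^ n)⁻¹‖)
      Filter.atTop (nhds ‖(-((e2 v)⁻¹ * 0) * (1 - (e2 v)⁻¹ * 0 : ℂ)⁻¹)‖) :=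
      Filter.Tendsto.norm (Filter.Tendsto.mul ht.neg
        (Filter.Tendsto.inv₀ (tendsto_const_nhds.sub ht) (by simp)))
    refine this.congr fun n => ?_
    congr 1
    have e : e2 (v + (-(n:ℂ)) * τ) = ((e2 v)⁻¹ * e2 τ ^ n)⁻¹ := by
      rw [e2_add, neg_mul, e2_neg, e2_nat_mul, mul_inv, inv_inv]
    rw [e]
    set y := (e2 v)⁻¹ * e2 τ ^ n with hy
    have hy0 : y ≠ 0 := mul_ne_zero (inv_ne_zero (e2_ne _)) (pow_ne_zero _ (e2_ne _))
    have : (1 - y⁻¹) = -(1 - y) * y⁻¹ := by field_simp; ring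
    rw [this, mul_inv, inv_inv, inv_neg]; ring
  obtain ⟨C1, hC1⟩ := h1.bddAbove_range
  obtain ⟨C2, hC2⟩ := h2.bddAbove_range
  refine ⟨max C1 C2, ?_, ?_⟩
  · exact le_trans (norm_nonneg _) (le_trans (hC1 ⟨0, rfl⟩) (le_max_left _ _))
  · intro k
    obtain ⟨n, rfl | rfl⟩ := k.eq_nat_or_neg
    · exact le_trans (by simpa using hC1 ⟨n, rfl⟩) (le_max_left _ _)
    · exact le_trans (by simpa using hC2 ⟨n, rfl⟩) (le_max_right _ _)

/-- vanishing theta sum -/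
lemma theta_vanish (τ : ℂ) (B : ℤ) :
    ∑' k : ℤ, e2 (k / 2 + ((k : ℂ) ^ 2 + k) / 2 * τ + k * B * τ) = 0 := by
  set f : ℤ → ℂ := fun k => e2 (k / 2 + ((k : ℂ) ^ 2 + k) / 2 * τ + k * B * τ) with hf
  have h : ∑' k, f ((Equiv.subLeft (-1 - 2 * B)) k) = ∑' k, f k := Equiv.tsum_eq _ f
  have h2 : ∀ k, f ((Equiv.subLeft (-1 - 2 * B)) k) = - f k := by
    intro k
    rw [show -f k = e2 (1 / 2) * f k by rw [e2_half]; ring, hf]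
    simp only [Equiv.subLeft_apply]
    rw [← e2_add]
    apply e2_congr (-1 - B - k)
    push_cast; ring
  simp_rw [h2, tsum_neg] at h
  have := self_eq_neg.1 h.symm
  exact this


/-! ### Finite `q`-identities -/

/-- `(q;q)_n` -/
def qfac (τ : ℂ) (n : ℕ) : ℂ := ∏ k ∈ Finset.range n, (1 - e2 (((k : ℂ) + 1) * τ))

/-- `1/(q;q)_K`, extended by zero to negative `K` -/
def qrec (τ : ℂ) (K : ℤ) : ℂ := if 0 ≤ K then (qfac τ K.toNat)⁻¹ else 0

lemma one_sub_ne {τ : ℂ} (hτ : 0 < τ.im) (k : ℤ) (hk : k ≠ 0) : 1 - e2 (k * τ) ≠ 0 := by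
  intro h
  obtain ⟨a, ha⟩ := e2_eq_one (sub_eq_zero.1 h).symm
  have := congrArg Complex.im ha
  simp at this
  rcases this with h | h
  · exact hk h
  · exact hτ.ne' h

lemma qfac_ne {τ : ℂ} (hτ : 0 < τ.im) (n : ℕ) : qfac τ n ≠ 0 := by
  unfold qfac
  rw [Finset.prod_ne_zero_iff]
  intro k _
  have := one_sub_ne hτ ((k : ℤ) + 1) (by omega)
  simpa using this

lemma qrec_neg (τ : ℂ) {K : ℤ} (h : K < 0) : qrec τ K = 0 := by
  unfold qrec; rw [if_neg (by omega)]

lemma qrec_nat (τ : ℂ) (n : ℕ) : qrec τ n = (qfac τ n)⁻¹ := by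
  unfold qrec; simp

lemma qrec_rec {τ : ℂ} (hτ : 0 < τ.im) (K : ℤ) :
    qrec τ (K - 1) = (1 - e2 (K * τ)) * qrec τ K := by
  rcases lt_trichotomy K 0 with h | h | h
  · rw [qrec_neg _ h, qrec_neg _ (by omega), mul_zero]
  · subst h
    rw [qrec_neg _ (by omega)]; simp [e2_zero]
  · obtain ⟨n, rfl⟩ : ∃ n : ℕ, K = n + 1 := ⟨(K - 1).toNat, by omega⟩
    rw [show ((n : ℤ) + 1 - 1) = (n : ℤ) by ring, show ((n : ℤ) + 1) = ((n + 1 : ℕ) : ℤ) by simp,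
      qrec_nat, qrec_nat]
    have h1 := qfac_ne hτ n
    have h2 := qfac_ne hτ (n + 1)
    have h3 : qfac τ (n + 1) = qfac τ n * (1 - e2 (((n : ℂ) + 1) * τ)) := by
      unfold qfac; rw [Finset.prod_range_succ]
    rw [h3] at h2 ⊢
    have h4 := right_ne_zero_of_mul h2
    push_cast
    field_simp

/-- normalised Gaussian binomial coefficient -/
def qbin (τ : ℂ) (n K : ℤ) : ℂ := qrec τ K * qrec τ (n - K)

lemma qbin_supp (τ : ℂ) (n K : ℤ) (h : K ∉ Finset.Icc 0 n) : qbin τ n K = 0 := by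
  unfold qbin
  rw [Finset.mem_Icc] at h
  by_cases h0 : K < 0
  · rw [qrec_neg _ h0, zero_mul]
  · rw [qrec_neg τ (K := n - K) (by omega), mul_zero]

lemma summable_qbin (τ : ℂ) (n : ℤ) (f : ℤ → ℂ) : Summable fun K => qbin τ n K * f K :=
  summable_of_ne_finset_zero (s := Finset.Icc 0 n) fun K hK => by rw [qbin_supp _ _ _ hK, zero_mul]

lemma pascal1 {τ : ℂ} (hτ : 0 < τ.im) (n K : ℤ) :
    (1 - e2 ((n + 1) * τ)) * qbin τ (n + 1) K =
      qbin τ n K + e2 ((n + 1 - K) * τ) * qbin τ n (K - 1) := by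
  unfold qbin
  have h1 := qrec_rec hτ K
  have h2 := qrec_rec hτ (n + 1 - K)
  rw [show n + 1 - K - 1 = n - K by ring] at h2
  rw [show n - (K - 1) = n + 1 - K by ring, h1, h2]
  push_cast
  rw [show e2 (((n : ℂ) + 1) * τ) = e2 ((n + 1 - K) * τ) * e2 (K * τ) by
    rw [← e2_add]; congr 1; ring]
  ring

lemma pascal2 {τ : ℂ} (hτ : 0 < τ.im) (n K : ℤ) :
    (1 - e2 ((n + 1) * τ)) * qbin τ (n + 1) K =
      e2 (K * τ) * qbin τ n K + qbin τ n (K - 1) := by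
  unfold qbin
  have h1 := qrec_rec hτ K
  have h2 := qrec_rec hτ (n + 1 - K)
  rw [show n + 1 - K - 1 = n - K by ring] at h2
  rw [show n - (K - 1) = n + 1 - K by ring, h1, h2]
  push_cast
  rw [show e2 (((n : ℂ) + 1) * τ) = e2 ((n + 1 - K) * τ) * e2 (K * τ) by
    rw [← e2_add]; congr 1; ring]
  ring

def Asum (τ : ℂ) (n : ℤ) (x : ℂ) : ℂ :=
  ∑' K : ℤ, qbin τ n K * e2 (K / 2 + ((K : ℂ) ^ 2 - K) / 2 * τ + K * x)

def Bsum (τ : ℂ) (n : ℤ) (t x : ℂ) : ℂ :=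
  ∑' K : ℤ, qbin τ n K *
    (e2 (K / 2 + ((K : ℂ) ^ 2 + K) / 2 * τ - t * K * τ) / (1 - e2 (x + K * τ)))

lemma tsum_shift (f : ℤ → ℂ) : ∑' K, f K = ∑' K, f (K + 1) :=
  (Equiv.tsum_eq (Equiv.addRight (1 : ℤ)) f).symm

lemma summable_shift {f : ℤ → ℂ} (h : Summable fun K => f (K + 1)) : Summable f :=
  (Equiv.summable_iff (Equiv.addRight (1 : ℤ))).1 h

lemma tsum_pascal (τ : ℂ) (n : ℤ) (f g h : ℤ → ℂ) (c : ℂ)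
    (H : ∀ K, c * qbin τ (n + 1) K = g K * qbin τ n K + h K * qbin τ n (K - 1)) :
    c * ∑' K, qbin τ (n + 1) K * f K =
      ∑' K, qbin τ n K * (g K * f K) + ∑' K, qbin τ n K * (h (K + 1) * f (K + 1)) := by
  have e : ∑' K, qbin τ n K * (h (K + 1) * f (K + 1)) =
      ∑' K, qbin τ n (K - 1) * (h K * f K) := by
    rw [tsum_shift fun K => qbin τ n (K - 1) * (h K * f K)]
    simp
  rw [e, ← tsum_mul_left, ← Summable.tsum_add]
  · refine tsum_congr fun K => ?_
    rw [← mul_assoc, H]; ring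
  · exact summable_qbin _ _ _
  · apply summable_shift
    simpa using summable_qbin τ n fun K => h (K + 1) * f (K + 1)

lemma Asum_rec {τ : ℂ} (hτ : 0 < τ.im) (n : ℤ) (x : ℂ) :
    (1 - e2 ((n + 1) * τ)) * Asum τ (n + 1) x = (1 - e2 (x + n * τ)) * Asum τ n x := by
  unfold Asum
  rw [tsum_pascal τ n _ (fun _ => 1) (fun K => e2 ((n + 1 - K) * τ)) _
    (fun K => by rw [pascal1 hτ, one_mul]), sub_mul, one_mul, sub_eq_add_neg, ← neg_mul,
    ← tsum_mul_left (a := -e2 (x + n * τ))]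
  simp only [one_mul]
  congr 1
  refine tsum_congr fun K => ?_
  rw [← neg_one_mul (e2 (x + n * τ)), ← e2_half, mul_left_comm (e2 (1 / 2) * _)]
  congr 1
  simp only [← e2_add]
  congr 1; push_cast; ring

lemma Bsum_rec0 {τ : ℂ} (hτ : 0 < τ.im) (n : ℤ) (x : ℂ) :
    (1 - e2 ((n + 1) * τ)) * Bsum τ (n + 1) 0 x =
      Bsum τ n 0 x - e2 ((n + 1) * τ) * Bsum τ n 0 (x + τ) := by
  unfold Bsum
  rw [tsum_pascal τ n _ (fun _ => 1) (fun K => e2 ((n + 1 - K) * τ)) _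
    (fun K => by rw [pascal1 hτ, one_mul]), sub_eq_add_neg, ← neg_mul,
    ← tsum_mul_left (a := -e2 ((n + 1) * τ))]
  simp only [one_mul]
  congr 1
  refine tsum_congr fun K => ?_
  rw [← neg_one_mul (e2 ((n + 1) * τ)), ← e2_half, mul_left_comm (e2 (1 / 2) * _)]
  congr 1
  rw [← mul_div_assoc, ← mul_div_assoc]
  simp only [← e2_add]
  congr 2
  · push_cast; ring
  · congr 1; push_cast; ring

lemma Bsum_rec {τ : ℂ} (hτ : 0 < τ.im) (n : ℤ) (t x : ℂ) :
    (1 - e2 ((n + 1) * τ)) * Bsum τ (n + 1) (t + 1) x =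
      Bsum τ n t x - e2 (-t * τ) * Bsum τ n t (x + τ) := by
  unfold Bsum
  rw [tsum_pascal τ n _ (fun K => e2 (K * τ)) (fun K => 1) _
    (fun K => by rw [pascal2 hτ, one_mul]), sub_eq_add_neg, ← neg_mul,
    ← tsum_mul_left (a := -e2 (-t * τ))]
  simp only [one_mul]
  congr 1
  · refine tsum_congr fun K => ?_
    rw [← mul_div_assoc, ← e2_add]
    congr 3
    ring
  refine tsum_congr fun K => ?_
  rw [← neg_one_mul (e2 (-t * τ)), ← e2_half, mul_left_comm (e2 (1 / 2) * _)]
  congr 1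
  rw [← mul_div_assoc]
  simp only [← e2_add]
  congr 2
  · push_cast; ring
  · congr 1; push_cast; ring

lemma qbin_zero_tsum (τ : ℂ) (f : ℤ → ℂ) : ∑' K, qbin τ 0 K * f K = f 0 := by
  rw [tsum_eq_single 0]
  · have : qbin τ 0 0 = 1 := by simp [qbin, qrec, qfac]
    rw [this, one_mul]
  · intro K hK
    rw [qbin_supp, zero_mul]
    simp; omega

lemma Asum_eq {τ : ℂ} (hτ : 0 < τ.im) (n : ℕ) (x : ℂ) :
    qfac τ n * Asum τ n x = ∏ k ∈ Finset.range n, (1 - e2 (x + k * τ)) := by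
  induction n with
  | zero =>
    unfold Asum
    simp only [Nat.cast_zero]
    rw [qbin_zero_tsum]
    simp [qfac, e2_zero]
  | succ n ih =>
    rw [Finset.prod_range_succ, ← ih]
    have h := Asum_rec hτ n x
    have h3 : qfac τ (n + 1) = qfac τ n * (1 - e2 (((n : ℂ) + 1) * τ)) := by
      unfold qfac; rw [Finset.prod_range_succ]
    rw [h3]
    push_cast at h ⊢
    rw [mul_assoc, h]; ring

lemma Bsum_eq {τ : ℂ} (hτ : 0 < τ.im) (n : ℕ) : ∀ (t : ℕ) (x : ℂ), t ≤ n →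
    (∀ k : ℤ, 1 - e2 (x + k * τ) ≠ 0) →
    (∏ k ∈ Finset.range (n + 1), (1 - e2 (x + k * τ))) * Bsum τ n t x = e2 (t * x) := by
  induction n with
  | zero =>
    intro t x ht hx
    obtain rfl : t = 0 := by omega
    unfold Bsum
    simp only [Nat.cast_zero]
    rw [qbin_zero_tsum]
    have := hx 0
    simp [e2_zero] at this ⊢
    field_simp
  | succ n ih =>
    intro t x ht hx
    have hx' : ∀ k : ℤ, 1 - e2 (x + τ + k * τ) ≠ 0 := by
      intro k
      have := hx (k + 1)
      push_cast at this
      rwa [show x + τ + k * τ = x + (k + 1) * τ by ring]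
    have hp : ∏ k ∈ Finset.range (n + 1 + 1), (1 - e2 (x + k * τ)) =
        (1 - e2 x) * ∏ k ∈ Finset.range (n + 1), (1 - e2 (x + τ + k * τ)) := by
      rw [Finset.prod_range_succ']
      simp only [Nat.cast_zero, zero_mul, add_zero]
      rw [mul_comm]
      congr 1
      refine Finset.prod_congr rfl fun k _ => ?_
      congr 2; push_cast; ring
    have hp2 : ∏ k ∈ Finset.range (n + 1 + 1), (1 - e2 (x + k * τ)) =
        (1 - e2 (x + (n + 1) * τ)) * ∏ k ∈ Finset.range (n + 1), (1 - e2 (x + k * τ)) := by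
      rw [Finset.prod_range_succ]
      push_cast
      rw [mul_comm]
    have hq : (1 - e2 (((n : ℂ) + 1) * τ)) ≠ 0 := by
      have := one_sub_ne hτ ((n : ℤ) + 1) (by omega)
      simpa using this
    apply mul_left_cancel₀ hq
    rw [mul_left_comm]
    rcases t with _ | t
    · have h := Bsum_rec0 hτ n x
      have i1 := ih 0 x (by omega) hx
      have i2 := ih 0 (x + τ) (by omega) hx'
      push_cast at h i1 i2 ⊢
      rw [h, mul_sub]
      nth_rw 1 [hp2]
      rw [hp, mul_assoc, i1,
        show (1 - e2 x) * (∏ k ∈ Finset.range (n + 1), (1 - e2 (x + τ + k * τ))) *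
          (e2 ((n + 1) * τ) * Bsum τ n 0 (x + τ)) = (1 - e2 x) * e2 ((n + 1) * τ) *
          ((∏ k ∈ Finset.range (n + 1), (1 - e2 (x + τ + k * τ))) * Bsum τ n 0 (x + τ)) by ring,
        i2, e2_add x]
      simp only [zero_mul, e2_zero]
      ring
    · have h := Bsum_rec hτ n t x
      have i1 := ih t x (by omega) hx
      have i2 := ih t (x + τ) (by omega) hx'
      push_cast at h i1 i2 ⊢
      rw [h, mul_sub]
      nth_rw 1 [hp2]
      rw [hp, mul_assoc, i1,
        show (1 - e2 x) * (∏ k ∈ Finset.range (n + 1), (1 - e2 (x + τ + k * τ))) *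
          (e2 (-t * τ) * Bsum τ n t (x + τ)) = (1 - e2 x) * e2 (-t * τ) *
          ((∏ k ∈ Finset.range (n + 1), (1 - e2 (x + τ + k * τ))) * Bsum τ n t (x + τ)) by ring,
        i2, e2_add x, mul_assoc (1 - e2 x), ← e2_add (-t * τ),
        show -(t : ℂ) * τ + t * (x + τ) = t * x by ring,
        show ((t : ℂ) + 1) * x = t * x + x by ring, e2_add]
      ring

/-- key finite identity -/
lemma AB_eq {τ : ℂ} (hτ : 0 < τ.im) (n t : ℕ) (ht : t ≤ n) (x : ℂ)
    (hx : ∀ k : ℤ, 1 - e2 (x + k * τ) ≠ 0) :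
    (qfac τ n * (1 - e2 (x + n * τ))) * (Asum τ n x * Bsum τ n t x) = e2 (t * x) := by
  rw [← Bsum_eq hτ n t x ht hx, Finset.prod_range_succ, ← Asum_eq hτ]
  ring


/-! ### Passing to the limit -/

def qphi (τ : ℂ) : ℂ := ∏' k : ℕ, (1 - e2 (((k : ℂ) + 1) * τ))

lemma norm_e2_lt {τ : ℂ} (hτ : 0 < τ.im) : ‖e2 τ‖ < 1 := by
  rw [norm_e2, Real.exp_lt_one_iff]
  have := Real.pi_pos
  nlinarith [mul_pos this hτ]

lemma summable_qpow {τ : ℂ} (hτ : 0 < τ.im) :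
    Summable fun k : ℕ => ‖-e2 (((k : ℂ) + 1) * τ)‖ := by
  have h := (summable_nat_add_iff 1).mpr
    (summable_geometric_of_lt_one (norm_nonneg _) (norm_e2_lt hτ))
  refine h.congr fun k => ?_
  have := e2_nat_mul (k + 1) τ
  push_cast at this
  rw [norm_neg, this, norm_pow]

lemma qfac_tendsto {τ : ℂ} (hτ : 0 < τ.im) :
    Filter.Tendsto (qfac τ) Filter.atTop (nhds (qphi τ)) := by
  have h := multipliable_one_add_of_summable (summable_qpow hτ)
  have h2 := h.tendsto_prod_tprod_nat
  simp only [← sub_eq_add_neg] at h2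
  exact h2

lemma qphi_ne {τ : ℂ} (hτ : 0 < τ.im) : qphi τ ≠ 0 := by
  unfold qphi
  simp only [sub_eq_add_neg]
  refine tprod_one_add_ne_zero_of_summable (f := fun k : ℕ => -e2 (((k : ℂ) + 1) * τ)) ?_
    (summable_qpow hτ)
  intro k
  have := one_sub_ne hτ ((k : ℤ) + 1) (by omega)
  simpa [sub_eq_add_neg] using this

lemma qrec_tendsto {τ : ℂ} (hτ : 0 < τ.im) :
    Filter.Tendsto (qrec τ) Filter.atTop (nhds (qphi τ)⁻¹) := by
  have h := ((qfac_tendsto hτ).inv₀ (qphi_ne hτ)).comp (show Filter.Tendsto Int.toNat Filter.atTop Filter.atTop from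
    Filter.tendsto_atTop_atTop.2 fun b => ⟨b, fun a ha => by omega⟩)
  refine h.congr' ?_
  filter_upwards [Filter.eventually_ge_atTop 0] with K hK
  simp [qrec, hK]

lemma qrec_bdd {τ : ℂ} (hτ : 0 < τ.im) : ∃ C : ℝ, 0 ≤ C ∧ ∀ K, ‖qrec τ K‖ ≤ C := by
  have h := ((qfac_tendsto hτ).inv₀ (qphi_ne hτ)).norm
  obtain ⟨C, hC⟩ := h.bddAbove_range
  have h0 : 0 ≤ C := le_trans (norm_nonneg _) (hC ⟨0, rfl⟩)
  refine ⟨C, h0, fun K => ?_⟩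
  unfold qrec
  split_ifs
  · exact hC ⟨K.toNat, rfl⟩
  · simpa using h0

lemma qbin_limit {τ : ℂ} (hτ : 0 < τ.im) (f : ℤ → ℂ) (hf : Summable f) :
    Filter.Tendsto (fun N : ℕ => ∑' k : ℤ, qbin τ (2 * N) (k + N) * f k) Filter.atTop
      (nhds (∑' k, (qphi τ)⁻¹ * (qphi τ)⁻¹ * f k)) := by
  obtain ⟨C, hC0, hC⟩ := qrec_bdd hτ
  refine tendsto_tsum_of_dominated_convergence (bound := fun k => C * C * ‖f k‖)
    (hf.norm.mul_left _) ?_ ?_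
  · intro k
    refine Filter.Tendsto.mul_const _ (Filter.Tendsto.mul ?_ ?_)
    · exact (qrec_tendsto hτ).comp
        (Filter.tendsto_atTop_add_const_left _ k tendsto_natCast_atTop_atTop)
    · refine ((qrec_tendsto hτ).comp
        (Filter.tendsto_atTop_add_const_left _ (-k) tendsto_natCast_atTop_atTop)).congr fun N => ?_
      simp only [Function.comp]
      congr 1; ring
  · refine Filter.Eventually.of_forall fun N k => ?_
    rw [norm_mul]
    refine mul_le_mul_of_nonneg_right ?_ (norm_nonneg _)
    unfold qbin
    rw [norm_mul]
    exact mul_le_mul (hC _) (hC _) (norm_nonneg _) hC0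

/-- theta series -/
def vth (τ v : ℂ) : ℂ := ∑' i : ℤ, e2 (i / 2 + ((i : ℂ) ^ 2 - i) / 2 * τ + i * v)

/-- Appell type series -/
def Sser (τ v : ℂ) : ℂ :=
  ∑' k : ℤ, e2 (k / 2 + ((k : ℂ) ^ 2 + k) / 2 * τ) / (1 - e2 (v + k * τ))

lemma summable_vth {τ : ℂ} (hτ : 0 < τ.im) (v : ℂ) :
    Summable fun i : ℤ => e2 (i / 2 + ((i : ℂ) ^ 2 - i) / 2 * τ + i * v) := by
  refine (summable_gauss hτ (1 / 2) (by norm_num) (1 / 2 - τ / 2 + v)).congr fun i => ?_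
  congr 1; push_cast; ring

lemma summable_div {τ : ℂ} (hτ : 0 < τ.im) (v : ℂ) {f : ℤ → ℂ} (hf : Summable f) :
    Summable fun k : ℤ => f k / (1 - e2 (v + k * τ)) := by
  obtain ⟨C, hC0, hC⟩ := bdd_inv hτ v
  refine Summable.of_norm_bounded (hf.norm.mul_right C) fun k => ?_
  rw [div_eq_mul_inv, norm_mul]
  exact mul_le_mul_of_nonneg_left (hC k) (norm_nonneg _)

lemma summable_SB {τ : ℂ} (hτ : 0 < τ.im) (u : ℂ) :
    Summable fun k : ℤ => e2 (k / 2 + ((k : ℂ) ^ 2 + k) / 2 * τ + k * u) := by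
  refine (summable_gauss hτ (1 / 2) (by norm_num) (1 / 2 + τ / 2 + u)).congr fun i => ?_
  congr 1; push_cast; ring

lemma summable_S {τ : ℂ} (hτ : 0 < τ.im) (v : ℂ) :
    Summable fun k : ℤ => e2 (k / 2 + ((k : ℂ) ^ 2 + k) / 2 * τ) / (1 - e2 (v + k * τ)) := by
  apply summable_div hτ
  simpa using summable_SB hτ 0

lemma tsum_addN (f : ℤ → ℂ) (N : ℤ) : ∑' K, f K = ∑' K, f (K + N) :=
  (Equiv.tsum_eq (Equiv.addRight N) f).symm

lemma centered {τ : ℂ} (hτ : 0 < τ.im) (v : ℂ) (hv : ∀ k : ℤ, 1 - e2 (v + k * τ) ≠ 0) (N : ℕ) :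
    qfac τ (2 * N) * (1 - e2 (v + N * τ)) *
      ((∑' k : ℤ, qbin τ (2 * N) (k + N) * e2 (k / 2 + ((k : ℂ) ^ 2 - k) / 2 * τ + k * v)) *
       (∑' k : ℤ, qbin τ (2 * N) (k + N) *
          (e2 (k / 2 + ((k : ℂ) ^ 2 + k) / 2 * τ) / (1 - e2 (v + k * τ))))) = 1 := by
  have h := AB_eq hτ (2 * N) N (by omega) (v - N * τ) (by
    intro k
    have := hv (k - N)
    push_cast at this
    rwa [show v - N * τ + k * τ = v + (k - N) * τ by ring])
  have hA : Asum τ (2 * N) (v - N * τ) = e2 (N / 2 - ((N : ℂ) ^ 2 + N) / 2 * τ + N * v) *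
      ∑' k : ℤ, qbin τ (2 * N) (k + N) * e2 (k / 2 + ((k : ℂ) ^ 2 - k) / 2 * τ + k * v) := by
    unfold Asum
    rw [tsum_addN _ N, ← tsum_mul_left]
    refine tsum_congr fun k => ?_
    rw [mul_left_comm (e2 _), ← e2_add]
    congr 2; push_cast; ring
  have hB : Bsum τ (2 * N) N (v - N * τ) = e2 (N / 2 + (N - (N : ℂ) ^ 2) / 2 * τ) *
      ∑' k : ℤ, qbin τ (2 * N) (k + N) *
          (e2 (k / 2 + ((k : ℂ) ^ 2 + k) / 2 * τ) / (1 - e2 (v + k * τ))) := by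
    unfold Bsum
    rw [tsum_addN _ N, ← tsum_mul_left]
    refine tsum_congr fun k => ?_
    rw [mul_left_comm (e2 _)]
    congr 1
    rw [← mul_div_assoc (e2 _), ← e2_add]
    congr 2
    · push_cast; ring
    · congr 1; push_cast; ring
  push_cast at h
  rw [hA, hB] at h
  have he : e2 (N / 2 - ((N : ℂ) ^ 2 + N) / 2 * τ + N * v) * e2 (N / 2 + (N - (N : ℂ) ^ 2) / 2 * τ)
      = e2 (N * (v - N * τ)) := by
    rw [← e2_add]
    apply e2_congr N
    push_cast; ring
  apply mul_left_cancel₀ (e2_ne (N * (v - N * τ)))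
  rw [mul_one]
  conv_rhs => rw [← h]
  rw [← he, show v - (N : ℂ) * τ + 2 * N * τ = v + N * τ by ring]
  ring

lemma S_mul_vth {τ : ℂ} (hτ : 0 < τ.im) (v : ℂ) (hv : ∀ k : ℤ, 1 - e2 (v + k * τ) ≠ 0) :
    Sser τ v * vth τ v = qphi τ ^ 3 := by
  have h1 := qbin_limit hτ _ (summable_vth hτ v)
  have h2 := qbin_limit hτ _ (summable_S hτ v)
  have h3 : Filter.Tendsto (fun N : ℕ => qfac τ (2 * N)) Filter.atTop (nhds (qphi τ)) :=
    (qfac_tendsto hτ).comp (Filter.tendsto_id.const_mul_atTop' (by norm_num))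
  have h4 : Filter.Tendsto (fun N : ℕ => 1 - e2 (v + N * τ)) Filter.atTop
      (nhds (1 - e2 v * 0)) := by
    refine tendsto_const_nhds.sub ?_
    refine ((tendsto_pow_atTop_nhds_zero_of_norm_lt_one (norm_e2_lt hτ)).const_mul
      (e2 v)).congr fun n => ?_
    rw [e2_add, e2_nat_mul]
  have h5 := (h3.mul h4).mul (h1.mul h2)
  have h6 := tendsto_nhds_unique (h5.congr fun N => centered hτ v hv N) tendsto_const_nhds
  rw [tsum_mul_left, tsum_mul_left] at h6
  have hp := qphi_ne hτ
  change qphi τ * (1 - e2 v * 0) * ((qphi τ)⁻¹ * (qphi τ)⁻¹ * vth τ v *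
    ((qphi τ)⁻¹ * (qphi τ)⁻¹ * Sser τ v)) = 1 at h6
  field_simp at h6
  rw [mul_comm]
  simpa using h6

/-- shifting the Appell series -/
lemma Sser_shift {τ : ℂ} (hτ : 0 < τ.im) (v : ℂ) (hv : ∀ k : ℤ, 1 - e2 (v + k * τ) ≠ 0) (B : ℤ) :
    Sser τ v = ∑' k : ℤ, e2 (k / 2 + ((k : ℂ) ^ 2 + k) / 2 * τ + k * (B * τ) + B * v) /
      (1 - e2 (v + k * τ)) := by
  have step : ∀ B : ℤ, ∑' k : ℤ, e2 (k / 2 + ((k : ℂ) ^ 2 + k) / 2 * τ + k * (B * τ) + B * v) /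
      (1 - e2 (v + k * τ)) = ∑' k : ℤ, e2 (k / 2 + ((k : ℂ) ^ 2 + k) / 2 * τ +
        k * (((B + 1 : ℤ) : ℂ) * τ) + ((B + 1 : ℤ) : ℂ) * v) / (1 - e2 (v + k * τ)) := by
    intro B
    have hs : ∀ B : ℤ, Summable fun k : ℤ => e2 (k / 2 + ((k : ℂ) ^ 2 + k) / 2 * τ + k * (B * τ)
        + B * v) / (1 - e2 (v + k * τ)) := by
      intro B
      apply summable_div hτ
      refine ((summable_SB hτ (B * τ)).mul_right (e2 (B * v))).congr fun k => ?_
      rw [← e2_add]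
    rw [← sub_eq_zero, ← Summable.tsum_sub (hs B) (hs (B + 1))]
    have e : ∀ k : ℤ, e2 (k / 2 + ((k : ℂ) ^ 2 + k) / 2 * τ + k * (B * τ)
        + B * v) / (1 - e2 (v + k * τ)) - e2 (k / 2 + ((k : ℂ) ^ 2 + k) / 2 * τ +
        k * (((B + 1 : ℤ) : ℂ) * τ) + ((B + 1 : ℤ) : ℂ) * v) / (1 - e2 (v + k * τ)) =
        e2 (k / 2 + ((k : ℂ) ^ 2 + k) / 2 * τ + k * B * τ) * e2 (B * v) := by
      intro k
      rw [← sub_div, div_eq_iff (hv k), ← e2_add, mul_sub, ← e2_add]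
      congr 1
      · rw [mul_one]; congr 1; ring
      · congr 1; push_cast; ring
    simp_rw [e]
    rw [tsum_mul_right, theta_vanish, zero_mul]
  induction B using Int.induction_on with
  | zero => simp [Sser]
  | succ i ih => rw [ih, step]
  | pred i ih => rw [ih, step (-(i : ℤ) - 1)]; simp


/-! ### Root of unity projection -/

lemma root_sum (M : ℕ) (hM : 0 < M) (s : ℕ) (hs : s < M) :
    ∑ ℓ ∈ Finset.range M, e2 (-((s : ℂ) * ℓ / M)) = if s = 0 then (M : ℂ) else 0 := by
  have hM' : (M : ℂ) ≠ 0 := by exact_mod_cast hM.ne'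
  split_ifs with h
  · subst h; simp [e2_zero]
  · have e : ∀ ℓ : ℕ, e2 (-((s : ℂ) * ℓ / M)) = e2 (-(s / M)) ^ ℓ := by
      intro ℓ
      rw [← e2_nat_mul]; congr 1; ring
    simp_rw [e]
    have hne : 1 - e2 (-((s : ℂ) / M)) ≠ 0 := by
      intro h0
      obtain ⟨a, ha⟩ := e2_eq_one (sub_eq_zero.1 h0).symm
      have h1 : (-(s : ℂ)) = a * M := by
        rw [← ha]; field_simp
      have h2 : -(s : ℤ) = a * M := by exact_mod_cast h1
      have h3 : (M : ℤ) ∣ s := ⟨-a, by linarith⟩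
      have h4 : M ∣ s := by exact_mod_cast h3
      exact h (Nat.eq_zero_of_dvd_of_lt h4 hs)
    apply mul_right_cancel₀ hne
    rw [geom_sum_mul_neg, ← e2_nat_mul, zero_mul, sub_eq_zero]
    have : (M : ℂ) * -((s : ℂ) / M) = ((-(s : ℤ) : ℤ) : ℂ) := by
      push_cast; field_simp
    rw [this, e2_int]

lemma proj_sum (M : ℕ) (hM : 0 < M) (x : ℂ) (hx : 1 - e2 (M * x) ≠ 0) :
    ∑ ℓ ∈ Finset.range M, (1 - e2 (x - (ℓ : ℂ) / M))⁻¹ = M / (1 - e2 (M * x)) := by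
  have hM' : (M : ℂ) ≠ 0 := by exact_mod_cast hM.ne'
  have h : ∀ ℓ : ℕ, (1 - e2 (x - (ℓ : ℂ) / M))⁻¹ =
      (∑ s ∈ Finset.range M, e2 (s * x) * e2 (-((s : ℂ) * ℓ / M))) / (1 - e2 (M * x)) := by
    intro ℓ
    have hp : e2 (x - (ℓ : ℂ) / M) ^ M = e2 (M * x) := by
      rw [← e2_nat_mul]
      apply e2_congr (-(ℓ : ℤ))
      push_cast; field_simp; ring
    have hs : ∑ s ∈ Finset.range M, e2 (s * x) * e2 (-((s : ℂ) * ℓ / M)) =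
        ∑ s ∈ Finset.range M, e2 (x - (ℓ : ℂ) / M) ^ s := by
      refine Finset.sum_congr rfl fun s _ => ?_
      rw [← e2_nat_mul, ← e2_add]; congr 1; ring
    have hg := geom_sum_mul_neg (e2 (x - (ℓ : ℂ) / M)) M
    rw [hp] at hg
    have hne : 1 - e2 (x - (ℓ : ℂ) / M) ≠ 0 := by
      intro h0; rw [h0, mul_zero] at hg; exact hx hg.symm
    rw [hs, ← hg, inv_eq_one_div, div_eq_div_iff hne (by rw [hg]; exact hx)]
    ring
  simp_rw [h]
  rw [← Finset.sum_div, Finset.sum_comm]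
  congr 1
  simp_rw [← Finset.mul_sum]
  rw [Finset.sum_congr rfl fun s hs => by rw [root_sum M hM s (Finset.mem_range.1 hs)]]
  simp only [mul_ite, mul_zero]
  rw [Finset.sum_ite_eq' (Finset.range M) 0]
  simp [hM, e2_zero]

/-! ### Signed finite geometric sums -/

lemma geom_Ico (x : ℂ) (a b : ℤ) (h : a ≤ b) :
    (∑ t ∈ Finset.Ico a b, e2 (t * x)) * (1 - e2 x) = e2 (a * x) - e2 (b * x) := by
  induction b, h using Int.leInduction with
  | base => simp
  | succ b hab ih =>
    rw [← Finset.insert_Ico_right_eq_Ico_add_one hab, Finset.sum_insert (by simp), add_mul, ih]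
    push_cast
    rw [mul_sub, ← e2_add, show (b : ℂ) * x + x = (b + 1) * x by ring]
    ring

lemma signed_sum (x : ℂ) (hx : 1 - e2 x ≠ 0) (a b : ℤ) :
    ∑' t : ℤ, ((if a ≤ t ∧ t < b then e2 (t * x) else 0) -
      (if b ≤ t ∧ t < a then e2 (t * x) else 0)) = (e2 (a * x) - e2 (b * x)) / (1 - e2 x) := by
  have key : ∀ a b : ℤ, HasSum (fun t : ℤ => if a ≤ t ∧ t < b then e2 (t * x) else 0)
      (∑ t ∈ Finset.Ico a b, e2 (t * x)) := by
    intro a b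
    have h := hasSum_sum_of_ne_finset_zero (L := .unconditional ℤ) (s := Finset.Ico a b)
      (f := fun t : ℤ => if a ≤ t ∧ t < b then e2 (t * x) else 0) (by
        intro t ht
        rw [Finset.mem_Ico] at ht
        simp [ht])
    convert h using 1
    refine Finset.sum_congr rfl fun t ht => ?_
    rw [Finset.mem_Ico] at ht
    simp [ht]
  rw [((key a b).sub (key b a)).tsum_eq, eq_div_iff hx, sub_mul]
  rcases le_total a b with h | h
  · rw [geom_Ico x a b h, Finset.Ico_eq_empty (a := b) (by omega)]; simp
  · rw [geom_Ico x b a h, Finset.Ico_eq_empty (a := a) (by omega)]; simp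

/-! ### Summability of the indefinite series -/

lemma summable_indef {τ : ℂ} (hτ : 0 < τ.im) (M : ℕ) (α β : ℂ) :
    Summable fun x : ℤ × ℤ =>
      ((if 0 < x.2 ∧ x.2 ≤ x.1 then e2 ((x.1 : ℂ) / 2 +
          (((M : ℂ) + 1) / 2 * (x.1 + α) ^ 2 - M / 2 * (x.2 + β) ^ 2) * τ) else 0) -
      (if x.1 < x.2 ∧ x.2 ≤ 0 then e2 ((x.1 : ℂ) / 2 +
          (((M : ℂ) + 1) / 2 * (x.1 + α) ^ 2 - M / 2 * (x.2 + β) ^ 2) * τ) else 0)) := by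
  refine summable_two hτ (1 / 4) (by norm_num) (1 / 2 + ((M : ℂ) + 1) * α * τ) (-(M * β * τ))
    ‖e2 ((((M : ℂ) + 1) / 2 * α ^ 2 - M / 2 * β ^ 2) * τ)‖ _ ?_
  intro j p
  have key : p ^ 2 ≤ j ^ 2 → ‖e2 ((j : ℂ) / 2 +
          (((M : ℂ) + 1) / 2 * (j + α) ^ 2 - M / 2 * (p + β) ^ 2) * τ)‖ ≤
      ‖e2 ((((M : ℂ) + 1) / 2 * α ^ 2 - M / 2 * β ^ 2) * τ)‖ *
      (‖e2 ((j : ℂ) ^ 2 * ((1 / 4 : ℝ) * τ) + j * (1 / 2 + ((M : ℂ) + 1) * α * τ))‖ *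
        ‖e2 ((p : ℂ) ^ 2 * ((1 / 4 : ℝ) * τ) + p * (-(M * β * τ)))‖) := by
    intro hjp
    have hjp' : (p : ℝ) ^ 2 ≤ (j : ℝ) ^ 2 := by exact_mod_cast hjp
    have hle : ‖e2 (((((M : ℝ) / 2 + 1 / 4) * ((j : ℝ) ^ 2 - (p : ℝ) ^ 2) : ℝ) : ℂ) * τ)‖ ≤ 1 := by
      rw [norm_e2, Real.exp_le_one_iff, Complex.im_ofReal_mul]
      have := Real.pi_pos
      have h1 : 0 ≤ ((M : ℝ) / 2 + 1 / 4) * ((j : ℝ) ^ 2 - (p : ℝ) ^ 2) :=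
        mul_nonneg (by positivity) (by linarith)
      have := mul_nonneg this.le (mul_nonneg h1 hτ.le)
      linarith
    rw [← norm_mul, ← norm_mul, ← e2_add, ← e2_add]
    rw [show (j : ℂ) / 2 + (((M : ℂ) + 1) / 2 * (j + α) ^ 2 - M / 2 * (p + β) ^ 2) * τ =
      ((((M : ℂ) + 1) / 2 * α ^ 2 - M / 2 * β ^ 2) * τ + ((j : ℂ) ^ 2 * ((1 / 4 : ℝ) * τ) +
        j * (1 / 2 + ((M : ℂ) + 1) * α * τ) + ((p : ℂ) ^ 2 * ((1 / 4 : ℝ) * τ) +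
        p * (-(M * β * τ))))) + ((((M : ℝ) / 2 + 1 / 4) * ((j : ℝ) ^ 2 - (p : ℝ) ^ 2) : ℝ) : ℂ) * τ
      by push_cast; ring, e2_add, norm_mul]
    exact mul_le_of_le_one_right (norm_nonneg _) hle
  simp only
  split_ifs with h1 h2 h2
  · omega
  · rw [sub_zero]; exact key (by nlinarith)
  · rw [zero_sub, norm_neg]; exact key (by nlinarith)
  · simp only [sub_self, norm_zero]; positivity


/-! ### The right-hand side -/

lemma jtheta_half (τ u : ℂ) :
    jtheta (-1) (1 / 2) (1 / 2) τ (2 * u) = -e2 (τ / 8 - u / 2) * vth τ u := by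
  unfold jtheta vth
  rw [tsum_addN _ (-1), ← tsum_mul_left]
  refine tsum_congr fun i => ?_
  rw [neg_one_zpow_e2, ← neg_one_mul (e2 (τ / 8 - u / 2)), ← e2_half, ← e2_add, ← e2_add, ← e2_add]
  apply e2_congr (-1)
  push_cast; ring

lemma eta_cube (τ : ℂ) : dedekindEta τ ^ 3 = e2 (τ / 8) * qphi τ ^ 3 := by
  unfold dedekindEta
  rw [mul_pow, ← e2_nat_mul]
  unfold qphi
  congr 2; push_cast; ring

lemma eta_div {τ : ℂ} (hτ : 0 < τ.im) (u : ℂ) (hu : ∀ k : ℤ, 1 - e2 (u + k * τ) ≠ 0) :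
    dedekindEta τ ^ 3 * (jtheta (-1) (1 / 2) (1 / 2) τ (2 * u))⁻¹ = -e2 (u / 2) * Sser τ u := by
  have h := S_mul_vth hτ u hu
  have hp : qphi τ ^ 3 ≠ 0 := pow_ne_zero _ (qphi_ne hτ)
  have hv : vth τ u ≠ 0 := by
    intro h0; rw [h0, mul_zero] at h; exact hp h.symm
  rw [jtheta_half, eta_cube, ← h, show τ / 8 = (τ / 8 - u / 2) + u / 2 by ring, e2_add,
    show τ / 8 - u / 2 + u / 2 - u / 2 = τ / 8 - u / 2 by ring]
  have := e2_ne (τ / 8 - u / 2)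
  generalize e2 (τ / 8 - u / 2) = X at *
  field_simp

lemma jtheta_num (M : ℕ) (ν : ℤ) (τ u : ℂ) :
    jtheta (-1) ((ν : ℂ) + 1 / 2) ((M : ℂ) / 2 + 1 / 2) τ (2 * u) * e2 (u / 2) =
      ∑' j : ℤ, e2 (j / 2 + ((M : ℂ) + 1) / 2 * (j + (ν + 1 / 2) / (M + 1)) ^ 2 * τ) *
        e2 (((M + 1) * j + ν + 1) * u) := by
  have hM' : (M : ℂ) + 1 ≠ 0 := by exact_mod_cast Nat.succ_ne_zero M
  unfold jtheta
  rw [← tsum_mul_right]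
  refine tsum_congr fun j => ?_
  rw [neg_one_zpow_e2, ← e2_add, ← e2_add, ← e2_add]
  congr 1
  have e : (ν + 1 / 2 : ℂ) / (2 * ((M : ℂ) / 2 + 1 / 2)) = (ν + 1 / 2) / (M + 1) := by
    congr 1; ring
  rw [e]
  field_simp
  ring

lemma summable_num {τ : ℂ} (hτ : 0 < τ.im) (M : ℕ) (a u d : ℂ) :
    Summable fun j : ℤ => e2 (j / 2 + ((M : ℂ) + 1) / 2 * (j + a) ^ 2 * τ) *
        e2 (((M + 1) * j + d) * u) := by
  refine (summable_gauss_add hτ (((M : ℝ) + 1) / 2) (by positivity)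
    (1 / 2 + (M + 1) * a * τ + (M + 1) * u) (((M : ℂ) + 1) / 2 * a ^ 2 * τ + d * u)).congr
      fun j => ?_
  rw [← e2_add]
  congr 1; push_cast; ring

/-- common double series term -/
def Tterm (M : ℕ) (n ν : ℤ) (τ v : ℂ) (j k : ℤ) : ℂ :=
  e2 (j / 2 + ((M : ℂ) + 1) / 2 * (j + (ν + 1 / 2) / (M + 1)) ^ 2 * τ) *
    (e2 (k / 2 + ((k : ℂ) ^ 2 + k) / 2 * τ + k * ((n - j - ν - 1) * τ) + (n + M * j) * v) /
      (1 - e2 (M * (v + k * τ))))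

lemma per_j {τ : ℂ} (hτ : 0 < τ.im) (M : ℕ) (hM : 0 < M) (n ν : ℤ) (v : ℂ)
    (hv : ∀ k : ℤ, 1 - e2 (M * (v + k * τ)) ≠ 0)
    (hu : ∀ (ℓ : ℕ) (k : ℤ), 1 - e2 (v - ℓ / M + k * τ) ≠ 0) (j : ℤ) :
    ∑ ℓ ∈ Finset.range M, e2 ((n : ℂ) * ℓ / M) * (e2 (((M + 1) * j + ν + 1) * (v - ℓ / M)) *
      Sser τ (v - ℓ / M)) =
    M * ∑' k : ℤ, e2 (k / 2 + ((k : ℂ) ^ 2 + k) / 2 * τ + k * ((n - j - ν - 1) * τ) +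
      (n + M * j) * v) / (1 - e2 (M * (v + k * τ))) := by
  have hM' : (M : ℂ) ≠ 0 := by exact_mod_cast hM.ne'
  have h1 : ∀ ℓ : ℕ, e2 ((n : ℂ) * ℓ / M) * (e2 (((M + 1) * j + ν + 1) * (v - ℓ / M)) *
      Sser τ (v - ℓ / M)) = ∑' k : ℤ, e2 (k / 2 + ((k : ℂ) ^ 2 + k) / 2 * τ +
        k * ((n - j - ν - 1) * τ) + (n + M * j) * v) / (1 - e2 (v - ℓ / M + k * τ)) := by
    intro ℓ
    rw [Sser_shift hτ _ (hu ℓ) (n - j - ν - 1), ← tsum_mul_left, ← tsum_mul_left]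
    refine tsum_congr fun k => ?_
    rw [← mul_div_assoc, ← mul_div_assoc, ← e2_add, ← e2_add]
    congr 1
    apply e2_congr (-j * ℓ)
    push_cast
    field_simp
    ring
  simp_rw [h1]
  rw [← Summable.tsum_finsetSum, ← tsum_mul_left]
  · refine tsum_congr fun k => ?_
    have := proj_sum M hM (v + k * τ) (hv k)
    rw [mul_div_left_comm, ← this, Finset.mul_sum]
    refine Finset.sum_congr rfl fun ℓ _ => ?_
    rw [div_eq_mul_inv]
    congr 4; ring
  · intro ℓ _
    apply summable_div hτ
    refine ((summable_SB hτ ((n - j - ν - 1) * τ)).mul_right (e2 ((n + M * j) * v))).congr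
      fun k => ?_
    rw [← e2_add]

lemma rhs_eq {τ : ℂ} (hτ : 0 < τ.im) (M : ℕ) (hM : 0 < M) (n ν : ℤ) (v : ℂ)
    (hv : ∀ k : ℤ, 1 - e2 (M * (v + k * τ)) ≠ 0)
    (hu : ∀ (ℓ : ℕ) (k : ℤ), 1 - e2 (v - ℓ / M + k * τ) ≠ 0) :
    dedekindEta τ ^ 3 * ∑ ℓ ∈ Finset.range M, e2 ((n : ℂ) * ℓ / M) *
      (jtheta (-1) ((ν : ℂ) + 1 / 2) ((M : ℂ) / 2 + 1 / 2) τ (2 * (v - ℓ / M)) /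
        jtheta (-1) (1 / 2) (1 / 2) τ (2 * (v - ℓ / M))) =
    -M * ∑' j : ℤ, ∑' k : ℤ, Tterm M n ν τ v j k := by
  have h1 : ∀ ℓ : ℕ, dedekindEta τ ^ 3 * (e2 ((n : ℂ) * ℓ / M) *
      (jtheta (-1) ((ν : ℂ) + 1 / 2) ((M : ℂ) / 2 + 1 / 2) τ (2 * (v - ℓ / M)) /
        jtheta (-1) (1 / 2) (1 / 2) τ (2 * (v - ℓ / M)))) =
      -∑' j : ℤ, e2 (j / 2 + ((M : ℂ) + 1) / 2 * (j + (ν + 1 / 2) / (M + 1)) ^ 2 * τ) *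
        (e2 ((n : ℂ) * ℓ / M) * (e2 (((M + 1) * j + ν + 1) * (v - ℓ / M)) *
        Sser τ (v - ℓ / M))) := by
    intro ℓ
    have a1 := eta_div hτ _ (hu ℓ)
    have a2 := jtheta_num M ν τ (v - ℓ / M)
    have a3 : ∑' j : ℤ, e2 (j / 2 + ((M : ℂ) + 1) / 2 * (j + (ν + 1 / 2) / (M + 1)) ^ 2 * τ) *
        (e2 ((n : ℂ) * ℓ / M) * (e2 (((M + 1) * j + ν + 1) * (v - ℓ / M)) *
        Sser τ (v - ℓ / M))) = (e2 ((n : ℂ) * ℓ / M) * Sser τ (v - ℓ / M)) *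
        ∑' j : ℤ, e2 (j / 2 + ((M : ℂ) + 1) / 2 * (j + (ν + 1 / 2) / (M + 1)) ^ 2 * τ) *
        e2 (((M + 1) * j + ν + 1) * (v - ℓ / M)) := by
      rw [← tsum_mul_left]
      refine tsum_congr fun j => ?_
      ring
    rw [a3, ← a2, div_eq_mul_inv (jtheta _ _ _ _ _)]
    linear_combination e2 ((n : ℂ) * ℓ / M) *
      jtheta (-1) ((ν : ℂ) + 1 / 2) ((M : ℂ) / 2 + 1 / 2) τ (2 * (v - ℓ / M)) * a1
  rw [Finset.mul_sum, Finset.sum_congr rfl fun ℓ _ => h1 ℓ, Finset.sum_neg_distrib,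
    ← Summable.tsum_finsetSum, neg_mul, ← tsum_mul_left]
  · congr 1
    refine tsum_congr fun j => ?_
    rw [← Finset.mul_sum, per_j hτ M hM n ν v hv hu j]
    unfold Tterm
    rw [tsum_mul_left]
    ring
  · intro ℓ _
    refine ((summable_num hτ M ((ν + 1 / 2) / (M + 1)) (v - ℓ / M) (ν + 1)).mul_right
      (e2 ((n : ℂ) * ℓ / M) * Sser τ (v - ℓ / M))).congr fun j => ?_
    rw [← add_assoc]; ring


/-! ### The left-hand side -/

/-- common coefficient -/
def Cterm (M : ℕ) (ν : ℤ) (τ : ℂ) (j k : ℤ) : ℂ :=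
  e2 ((j - k) / 2 + ((M : ℂ) + 1) / 2 * (j - k + (ν + 1 / 2) / (M + 1)) ^ 2 * τ -
    (M : ℂ) / 2 * k ^ 2 * τ)

def Hterm (M : ℕ) (n ν : ℤ) (τ v : ℂ) (j k : ℤ) : ℂ :=
  Cterm M ν τ j k * (e2 ((n + M * (k - ν)) * (v + k * τ)) / (1 - e2 (M * (v + k * τ))))

lemma Tterm_eq (M : ℕ) (n ν : ℤ) (τ v : ℂ) (j k : ℤ) :
    Tterm M n ν τ v j k =
      Cterm M ν τ j k * (e2 ((n + M * j) * (v + k * τ)) / (1 - e2 (M * (v + k * τ)))) := by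
  have hM' : (M : ℂ) + 1 ≠ 0 := by exact_mod_cast Nat.succ_ne_zero M
  unfold Tterm Cterm
  rw [← mul_div_assoc, ← mul_div_assoc, ← e2_add, ← e2_add]
  congr 1
  apply e2_congr k
  field_simp
  ring

lemma h_part {τ : ℂ} (hτ : 0 < τ.im) (M : ℕ) (hM : 0 < M) (n ν : ℤ) (v : ℂ) :
    HasSum (fun x : ℤ × ℤ => Hterm M n ν τ v x.1 x.2)
      (e2 (-((M : ℂ) / 2 * (ν : ℂ) ^ 2) * τ) *
        jtheta (-1) ((ν : ℂ) + 1 / 2) ((M : ℂ) / 2 + 1 / 2) τ 0 *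
          hfun ((M : ℂ) / 2) n ν τ (2 * v)) := by
  have hM1 : (M : ℂ) + 1 ≠ 0 := by exact_mod_cast Nat.succ_ne_zero M
  have hM0 : (0 : ℝ) < M := by exact_mod_cast hM
  set F : ℤ → ℂ := fun j => e2 (j / 2 + ((M : ℂ) + 1) / 2 * (j + (ν + 1 / 2) / (M + 1)) ^ 2 * τ)
    with hF
  set K : ℤ → ℂ := fun k => e2 (-((M : ℂ) / 2 * k ^ 2 * τ) + (n + M * (k - ν)) * (v + k * τ)) /
    (1 - e2 (M * v + k * (M * τ))) with hK
  have sF : Summable F := by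
    have := summable_num hτ M ((ν + 1 / 2) / (M + 1)) 0 0
    simp only [mul_zero, e2_zero, mul_one] at this
    exact this
  have sK : Summable K := by
    refine summable_div (τ := M * τ) (by simp; positivity) (M * v) ?_
    refine (summable_gauss_add hτ ((M : ℝ) / 2) (by positivity)
      (M * v + (n - M * ν) * τ) ((n - M * ν) * v)).congr fun k => ?_
    congr 1; push_cast; ring
  have e1 : jtheta (-1) ((ν : ℂ) + 1 / 2) ((M : ℂ) / 2 + 1 / 2) τ 0 = ∑' j, F j := by
    have := jtheta_num M ν τ 0
    simp only [mul_zero, zero_div, e2_zero, mul_one] at this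
    exact this
  have e2' : e2 (-((M : ℂ) / 2 * (ν : ℂ) ^ 2) * τ) * hfun ((M : ℂ) / 2) n ν τ (2 * v) =
      ∑' k, K k := by
    unfold hfun
    rw [tsum_addN _ (-ν), ← tsum_mul_left]
    refine tsum_congr fun k => ?_
    rw [hK, ← mul_div_assoc, ← e2_add]
    simp only
    congr 2
    · push_cast; ring
    · congr 1; push_cast; ring
  rw [mul_right_comm, e2', e1, mul_comm]
  have hs := summable_mul_of_summable_norm sF.norm sK.norm
  have hp := hs.hasSum
  rw [← tsum_mul_tsum_of_summable_norm sF.norm sK.norm] at hp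
  let e : ℤ × ℤ ≃ ℤ × ℤ :=
    { toFun := fun x => (x.1 - x.2, x.2)
      invFun := fun x => (x.1 + x.2, x.2)
      left_inv := fun x => by simp
      right_inv := fun x => by simp }
  rw [← e.hasSum_iff] at hp
  have hfun_eq : (fun x : ℤ × ℤ => Hterm M n ν τ v x.1 x.2) =
      ((fun x : ℤ × ℤ => F x.1 * K x.2) ∘ e) := by
    funext ⟨j, k⟩
    simp only [Function.comp, e, Equiv.coe_fn_mk, hF, hK]
    unfold Hterm Cterm
    rw [← mul_div_assoc, ← mul_div_assoc, ← e2_add, ← e2_add]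
    congr 2
    · push_cast; ring
    · congr 1; ring
  rw [hfun_eq]
  exact hp

lemma g_part {τ : ℂ} (hτ : 0 < τ.im) (M : ℕ) (hM : 0 < M) (n ν : ℤ) (v : ℂ)
    (hv : ∀ k : ℤ, 1 - e2 (M * (v + k * τ)) ≠ 0) :
    HasSum (fun x : ℤ × ℤ => (-1) ^ ν * (Tterm M n ν τ v x.1 x.2 - Hterm M n ν τ v x.1 x.2))
      (gfun ((M : ℂ) / 2) n ν τ * jtheta 1 (n : ℂ) ((M : ℂ) / 2) τ (2 * v)) := by
  have hM' : (M : ℂ) ≠ 0 := by exact_mod_cast hM.ne'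
  have hM1 : (M : ℂ) + 1 ≠ 0 := by exact_mod_cast Nat.succ_ne_zero M
  have hM0 : (0 : ℝ) < M := by exact_mod_cast hM
  set gt : ℤ × ℤ → ℂ := fun x =>
      ((if 0 < x.2 ∧ x.2 ≤ x.1 then e2 ((x.1 : ℂ) / 2 +
          (((M : ℂ) + 1) / 2 * (x.1 + (ν - (ν + 1 / 2) / (M + 1))) ^ 2 -
            M / 2 * (x.2 + (ν - n / M)) ^ 2) * τ) else 0) -
      (if x.1 < x.2 ∧ x.2 ≤ 0 then e2 ((x.1 : ℂ) / 2 +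
          (((M : ℂ) + 1) / 2 * (x.1 + (ν - (ν + 1 / 2) / (M + 1))) ^ 2 -
            M / 2 * (x.2 + (ν - n / M)) ^ 2) * τ) else 0)) with hgt
  set th : ℤ → ℂ := fun t => e2 ((M : ℂ) / 2 * (t + n / M) ^ 2 * τ + (M * t + n) * v) with hth
  have sg : Summable gt := summable_indef hτ M _ _
  have st : Summable th := by
    refine (summable_gauss_add hτ ((M : ℝ) / 2) (by positivity)
      (n * τ + M * v) ((M : ℂ) / 2 * (n / M) ^ 2 * τ + n * v)).congr fun k => ?_
    rw [hth]
    simp only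
    congr 1; push_cast; field_simp; ring
  have eg : gfun ((M : ℂ) / 2) n ν τ = ∑' x, gt x := by
    unfold gfun indefSum
    refine tsum_congr fun x => ?_
    rw [hgt]
    simp only
    have : (-1 : ℂ) ^ x.1 *
      e2 ((((M : ℂ) / 2 + 1 / 2) * ((x.1 : ℂ) + (ν : ℂ) - ((ν : ℂ) + 1 / 2) /
        (2 * ((M : ℂ) / 2) + 1)) ^ 2 -
        (M : ℂ) / 2 * ((x.2 : ℂ) + (ν : ℂ) - (n : ℂ) / (2 * ((M : ℂ) / 2))) ^ 2) * τ) =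
      e2 ((x.1 : ℂ) / 2 +
          (((M : ℂ) + 1) / 2 * (x.1 + (ν - (ν + 1 / 2) / (M + 1))) ^ 2 -
            M / 2 * (x.2 + (ν - n / M)) ^ 2) * τ) := by
      rw [neg_one_zpow_e2, ← e2_add, show 2 * ((M : ℂ) / 2) = M by ring]
      congr 1; ring
    rw [this]
  have et : jtheta 1 (n : ℂ) ((M : ℂ) / 2) τ (2 * v) = ∑' t, th t := by
    unfold jtheta
    refine tsum_congr fun t => ?_
    rw [one_zpow, one_mul, hth, show 2 * ((M : ℂ) / 2) = M by ring]
    simp only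
    congr 1; field_simp
  rw [eg, et]
  have hs := summable_mul_of_summable_norm sg.norm st.norm
  have hp := hs.hasSum
  rw [← tsum_mul_tsum_of_summable_norm sg.norm st.norm] at hp
  let e : (ℤ × ℤ) × ℤ ≃ (ℤ × ℤ) × ℤ :=
    { toFun := fun x => ((x.1.2 - x.1.1 - ν, x.1.2 - ν - x.2), x.2)
      invFun := fun x => ((x.1.2 + x.2 - x.1.1, x.1.2 + ν + x.2), x.2)
      left_inv := fun x => by ext <;> simp <;> ring
      right_inv := fun x => by ext <;> simp <;> ring }
  rw [← e.hasSum_iff] at hp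
  have hsum := hp.summable
  have hq := hp.prod_fiberwise fun x => (hsum.prod_factor x).hasSum
  have hfun_eq : (fun x : ℤ × ℤ =>
      (-1 : ℂ) ^ ν * (Tterm M n ν τ v x.1 x.2 - Hterm M n ν τ v x.1 x.2)) =
      fun x => ∑' b, ((fun x : (ℤ × ℤ) × ℤ => gt x.1 * th x.2) ∘ e) (x, b) := by
    funext ⟨j, k⟩
    have inner : ∀ t : ℤ, ((fun x : (ℤ × ℤ) × ℤ => gt x.1 * th x.2) ∘ e) ((j, k), t) =
        ((-1) ^ ν * Cterm M ν τ j k * e2 (n * (v + k * τ))) *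
        ((if j ≤ t ∧ t < k - ν then e2 (t * (M * (v + k * τ))) else 0) -
        (if k - ν ≤ t ∧ t < j then e2 (t * (M * (v + k * τ))) else 0)) := by
      intro t
      have key : e2 (((k - j - ν : ℤ) : ℂ) / 2 +
            (((M : ℂ) + 1) / 2 * (((k - j - ν : ℤ) : ℂ) + (ν - (ν + 1 / 2) / (M + 1))) ^ 2 -
              M / 2 * (((k - ν - t : ℤ) : ℂ) + (ν - n / M)) ^ 2) * τ) * th t =
          ((-1) ^ ν * Cterm M ν τ j k * e2 (n * (v + k * τ))) * e2 (t * (M * (v + k * τ))) := by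
        unfold Cterm
        rw [hth, neg_one_zpow_e2]
        simp only
        rw [← e2_add, ← e2_add, ← e2_add, ← e2_add]
        apply e2_congr (k - j - ν)
        push_cast
        field_simp
        ring
      simp only [Function.comp, e, Equiv.coe_fn_mk, hgt]
      rw [sub_mul, mul_sub, ite_mul, ite_mul, zero_mul, key, mul_ite, mul_ite, mul_zero]
      congr 1
      · refine if_congr ?_ rfl rfl
        omega
      · refine if_congr ?_ rfl rfl
        omega
    simp_rw [inner]
    rw [tsum_mul_left, signed_sum _ (hv k), Tterm_eq]
    unfold Hterm
    rw [show ((n : ℂ) + M * j) * (v + k * τ) = n * (v + k * τ) + j * (M * (v + k * τ)) by ring,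
      show ((n : ℂ) + M * (k - ν)) * (v + k * τ) =
        n * (v + k * τ) + ((k - ν : ℤ) : ℂ) * (M * (v + k * τ)) by push_cast; ring, e2_add, e2_add]
    ring
  rw [hfun_eq]
  exact hq

theorem stmt_8 (M : ℕ) (hM : 0 < M) (m : ℂ) (hm : m = (M : ℂ) / 2)
    (n ν : ℤ) (hn : 0 ≤ n ∧ n < (M : ℤ)) (hν : 0 ≤ ν ∧ ν ≤ (M : ℤ))
    (τ : ℂ) (hτ : 0 < τ.im) (z : ℂ)
    (hz : ∀ a b : ℤ, m * z ≠ (a : ℂ) + (b : ℂ) * τ) :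
    Gfun m n ν τ z =
      -((-1 : ℂ) ^ ν / (2 * m)) * dedekindEta τ ^ 3 *
        ∑ ℓ ∈ Finset.range M, e2 ((n : ℂ) * (ℓ : ℂ) / (2 * m)) *
          (jtheta (-1) ((ν : ℂ) + 1 / 2) (m + 1 / 2) τ (z - (ℓ : ℂ) / m) /
            jtheta (-1) (1 / 2) (1 / 2) τ (z - (ℓ : ℂ) / m)) := by
  have hM' : (M : ℂ) ≠ 0 := by exact_mod_cast hM.ne'
  subst hm
  obtain ⟨v, rfl⟩ : ∃ v, z = 2 * v := ⟨z / 2, by ring⟩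
  have hv : ∀ k : ℤ, 1 - e2 (M * (v + k * τ)) ≠ 0 := by
    intro k h0
    obtain ⟨a, ha⟩ := e2_eq_one (sub_eq_zero.1 h0).symm
    apply hz a (-(M * k))
    push_cast
    linear_combination ha
  have hu : ∀ (ℓ : ℕ) (k : ℤ), 1 - e2 (v - ℓ / M + k * τ) ≠ 0 := by
    intro ℓ k h0
    obtain ⟨a, ha⟩ := e2_eq_one (sub_eq_zero.1 h0).symm
    apply hz (M * a + ℓ) (-(M * k))
    have : v = a + ℓ / M - k * τ := by linear_combination ha
    rw [this]
    push_cast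
    field_simp
    ring
  have hR := rhs_eq hτ M hM n ν v hv hu
  have hH := (h_part hτ M hM n ν v).mul_left ((-1 : ℂ) ^ ν)
  have hG := g_part hτ M hM n ν v hv
  have hT := hG.add hH
  have hT' : HasSum (fun x : ℤ × ℤ => (-1 : ℂ) ^ ν * Tterm M n ν τ v x.1 x.2)
      (Gfun ((M : ℂ) / 2) n ν τ (2 * v)) := by
    unfold Gfun
    convert hT using 1
    · funext x; ring
    · ring
  have hT2 := hT'.summable.tsum_prod
  rw [hT'.tsum_eq] at hT2
  simp_rw [tsum_mul_left] at hT2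
  rw [hT2, show 2 * ((M : ℂ) / 2) = M by ring]
  have e : ∀ ℓ : ℕ, 2 * v - (ℓ : ℂ) / ((M : ℂ) / 2) = 2 * (v - ℓ / M) := by
    intro ℓ; field_simp
  simp_rw [e]
  rw [mul_assoc, hR]
  field_simp
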